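/- arXiv:1804.09501 — 2 statements merged into one kernel-verified Lean document; each statement's English description precedes it below -/
import Mathlib

section
/- (Order of the upcrossing probability, Lemma 4.7.) For every z > 0 there exist constants C > 0 and ε₀ > 0 such that for all 0 < ε < ε₀ one has (∫_ε^{2ε} g_ε(y) dy) / (∫_ε^{z} g_ε(y) dy) ≤ C·ε^{b/s² + 1}; in other words p_{ε,z} = O(ε^{b/s² + 1}) as ε → 0⁺. -/
open MeasureTheory Real Set Filter
open scoped Topology

/-- First-order Taylor bound at `0`. -/
lemma aux_taylor (f : ℝ → ℝ) (hf : ContDiffOn ℝ 2 f (Ici 0)) (hf0 : f 0 = 0) (z : ℝ) (hz : 0 < z) :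
    ∃ A ≥ (0 : ℝ), ∀ x ∈ Icc 0 z, |f x - derivWithin f (Ici 0) 0 * x| ≤ A * x ^ 2 := by
  have hf' : ContDiffOn ℝ ((1 : ℕ) + 1) f (Icc 0 z) := by
    have := hf.mono (Icc_subset_Ici_self : Icc 0 z ⊆ Ici 0)
    convert this using 1
    norm_num
  obtain ⟨C, hC⟩ := exists_taylor_mean_remainder_bound hz.le hf'
  have hd : derivWithin f (Icc 0 z) 0 = derivWithin f (Ici 0) 0 := by
    apply derivWithin_congr_set
    rw [eventuallyEq_set]
    filter_upwards [Iio_mem_nhds hz] with x hx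
    simp only [mem_Icc, mem_Ici, mem_Iio] at *
    exact ⟨fun h => h.1, fun h => ⟨h, hx.le⟩⟩
  refine ⟨|C|, abs_nonneg _, fun x hx => ?_⟩
  have h := hC x hx
  rw [taylorWithinEval_succ, taylor_within_zero_eval, iteratedDerivWithin_one, hd, hf0] at h
  simp only [Real.norm_eq_abs] at h
  norm_num at h
  rw [mul_comm]
  exact h.trans (mul_le_mul_of_nonneg_right (le_abs_self C) (sq_nonneg x))

lemma aux_lower (σ : ℝ → ℝ) (hσ : ContinuousOn σ (Ici 0)) (hpos : ∀ x, 0 < x → 0 < σ x)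
    (s A z : ℝ) (hs : 0 < s) (hA : 0 ≤ A) (hz : 0 < z)
    (hT : ∀ x ∈ Icc 0 z, |σ x - s * x| ≤ A * x ^ 2) :
    ∃ c > 0, ∀ x ∈ Icc 0 z, c * x ≤ σ x := by
  set δ := min z (s / (2 * (A + 1))) with hδ
  have hδ0 : 0 < δ := lt_min hz (by positivity)
  have hδz : δ ≤ z := min_le_left _ _
  obtain ⟨x0, hx0, hmin⟩ := isCompact_Icc.exists_isMinOn (nonempty_Icc.2 hδz)
    (hσ.mono (fun x hx => hδ0.le.trans hx.1) : ContinuousOn σ (Icc δ z))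
  have hm : 0 < σ x0 := hpos _ (hδ0.trans_le hx0.1)
  refine ⟨min (s / 2) (σ x0 / z), lt_min (by positivity) (by positivity), fun x hx => ?_⟩
  rcases le_total x δ with h | h
  · have h1 := (abs_le.1 (hT x hx)).1
    have h2 : x ≤ s / (2 * (A + 1)) := h.trans (min_le_right _ _)
    rw [le_div_iff₀ (by positivity)] at h2
    have h3 : min (s / 2) (σ x0 / z) * x ≤ s / 2 * x :=
      mul_le_mul_of_nonneg_right (min_le_left _ _) hx.1
    have h4 := mul_le_mul_of_nonneg_right h2 hx.1
    nlinarith [sq_nonneg x]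
  · have h3 : min (s / 2) (σ x0 / z) * x ≤ σ x0 / z * z :=
      mul_le_mul (min_le_right _ _) hx.2 hx.1 (by positivity)
    have h4 : σ x0 ≤ σ x := hmin ⟨h, hx.2⟩
    rw [div_mul_cancel₀ _ hz.ne'] at h3
    exact h3.trans h4

lemma aux_ratio (B2 S b s A B c z x : ℝ) (hb : 0 < b) (hs : 0 < s) (hA : 0 ≤ A)
    (hc : 0 < c) (hx : 0 < x) (hxz : x ≤ z)
    (hT : |S - s * x| ≤ A * x ^ 2) (hT2 : |B2 - b * x| ≤ B * x ^ 2) (hl : c * x ≤ S) :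
    |B2 / S ^ 2 - b / s ^ 2 / x| ≤ (B + b / s ^ 2 * A * (2 * s + A * z)) / c ^ 2 := by
  have hS : 0 < S := (mul_pos hc hx).trans_le hl
  set r := b / s ^ 2 with hr
  have hr0 : 0 < r := by positivity
  have hbr : b = r * s ^ 2 := by rw [hr]; field_simp
  have e : B2 / S ^ 2 - r / x = (B2 * x - r * S ^ 2) / (S ^ 2 * x) := by field_simp
  have e2 : B2 * x - r * S ^ 2 = (B2 - b * x) * x - r * ((S - s * x) * (S + s * x)) := by
    rw [hbr]; ring
  have hSu : S + s * x ≤ (2 * s + A * z) * x := by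
    have := (abs_le.1 hT).2
    nlinarith [mul_le_mul_of_nonneg_left hxz (mul_nonneg hA hx.le)]
  have hn : |B2 * x - r * S ^ 2| ≤ (B + r * A * (2 * s + A * z)) * x ^ 3 := by
    rw [e2]
    refine (abs_sub _ _).trans ?_
    rw [abs_mul, abs_mul, abs_mul, abs_of_pos hx, abs_of_pos hr0,
      abs_of_pos (by positivity : 0 < S + s * x)]
    have h1 := mul_le_mul_of_nonneg_right hT2 hx.le
    have h2 : |S - s * x| * (S + s * x) ≤ A * x ^ 2 * ((2 * s + A * z) * x) :=
      mul_le_mul hT hSu (by positivity) (by positivity)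
    have h3 := mul_le_mul_of_nonneg_left h2 hr0.le
    nlinarith
  have hN0 : 0 ≤ B + r * A * (2 * s + A * z) := by
    have := (abs_nonneg _).trans hn
    exact nonneg_of_mul_nonneg_left this (by positivity)
  rw [e, abs_div, abs_of_pos (by positivity : 0 < S ^ 2 * x), div_le_div_iff₀ (by positivity) (by positivity)]
  have h5 : c ^ 2 * x ^ 2 ≤ S ^ 2 := by
    rw [← mul_pow]; exact pow_le_pow_left₀ (by positivity) hl 2
  calc _ ≤ (B + r * A * (2 * s + A * z)) * x ^ 3 * c ^ 2 :=
        mul_le_mul_of_nonneg_right hn (by positivity)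
    _ = (B + r * A * (2 * s + A * z)) * (c ^ 2 * x ^ 2 * x) := by ring
    _ ≤ _ := mul_le_mul_of_nonneg_left (mul_le_mul_of_nonneg_right h5 hx.le) hN0

lemma aux_int (P r K y z : ℝ) (hy : 0 < y) (hyz : y ≤ z) :
    IntervalIntegrable (fun l => P / l ^ 2 - r / l + K) volume y z ∧
    ∫ l in y..z, (P / l ^ 2 - r / l + K) = P / y - P / z - r * log (z / y) + K * (z - y) := by
  have hi : IntervalIntegrable (fun l => P / l ^ 2 - r / l + K) volume y z := by
    apply ContinuousOn.intervalIntegrable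
    rw [uIcc_of_le hyz]
    have hne : ∀ x ∈ Icc y z, x ≠ 0 := fun x hx => (hy.trans_le hx.1).ne'
    have hne2 : ∀ x ∈ Icc y z, x ^ 2 ≠ 0 := fun x hx => pow_ne_zero _ (hne x hx)
    exact ((continuousOn_const.div (continuousOn_id.pow 2) hne2).sub
      (continuousOn_const.div continuousOn_id hne)).add continuousOn_const
  refine ⟨hi, ?_⟩
  rw [intervalIntegral.integral_eq_sub_of_hasDerivAt
    (f := fun l => -(P * l⁻¹) - r * log l + K * l) _ hi]
  · rw [Real.log_div (hy.trans_le hyz).ne' hy.ne']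
    simp only [div_eq_mul_inv]
    ring
  · intro x hx
    rw [uIcc_of_le hyz] at hx
    have hx0 : x ≠ 0 := (hy.trans_le hx.1).ne'
    have := ((((hasDerivAt_inv hx0).const_mul P).neg).sub ((Real.hasDerivAt_log hx0).const_mul r)).add
      ((hasDerivAt_id x).const_mul K)
    refine HasDerivAt.congr_deriv (f := fun l => -(P * l⁻¹) - r * log l + K * l) this ?_
    simp only [div_eq_mul_inv]
    ring

/-- (Order of the upcrossing probability, Lemma 4.7.) For every `z > 0` there exist `C > 0` and
`ε₀ > 0` such that for all `0 < ε < ε₀` one has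
`(∫_ε^{2ε} g_ε(y) dy) / (∫_ε^{z} g_ε(y) dy) ≤ C·ε^{b/s² + 1}`, i.e. `p_{ε,z} = O(ε^{b/s²+1})`. -/
theorem statement2
    (b1 b2 σ : ℝ → ℝ)
    (hb1 : ContDiffOn ℝ 1 b1 (Ici 0))
    (hb1inf : ∃ m > 0, ∀ x ∈ Ici (0 : ℝ), m ≤ b1 x)
    (hb1sup : ∃ M : ℝ, ∀ x ∈ Ici (0 : ℝ), b1 x ≤ M)
    (hb2 : ContDiffOn ℝ 2 b2 (Ici 0))
    (hb2nonneg : ∀ x ∈ Ici (0 : ℝ), 0 ≤ b2 x)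
    (hb20 : b2 0 = 0)
    (hσ : ContDiffOn ℝ 2 σ (Ici 0))
    (hσnonneg : ∀ x ∈ Ici (0 : ℝ), 0 ≤ σ x)
    (hσzero : ∀ x ∈ Ici (0 : ℝ), (σ x = 0 ↔ x = 0))
    (b s : ℝ)
    (hb : b = derivWithin b2 (Ici 0) 0) (hbpos : 0 < b)
    (hs : s = derivWithin σ (Ici 0) 0) (hspos : 0 < s)
    (z : ℝ) (hz : 0 < z) :
    ∃ C > (0 : ℝ), ∃ ε₀ > (0 : ℝ), ∀ ε : ℝ, 0 < ε → ε < ε₀ →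
      (∫ y in ε..(2 * ε), Real.exp (∫ l in y..z, (ε * b1 l - b2 l) / σ l ^ 2)) /
          (∫ y in ε..z, Real.exp (∫ l in y..z, (ε * b1 l - b2 l) / σ l ^ 2)) ≤
        C * ε ^ (b / s ^ 2 + 1) := by
  have hσ0 : σ 0 = 0 := (hσzero 0 self_mem_Ici).2 rfl
  have hσpos : ∀ x, 0 < x → 0 < σ x := fun x hx =>
    lt_of_le_of_ne (hσnonneg x hx.le) (fun h => hx.ne' ((hσzero x hx.le).1 h.symm))
  obtain ⟨m, hm, hmb⟩ := hb1inf
  obtain ⟨M, hMb⟩ := hb1sup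
  have hM : 0 < M := hm.trans_le ((hmb 0 self_mem_Ici).trans (hMb 0 self_mem_Ici))
  obtain ⟨A, hA, hTσ⟩ := aux_taylor σ hσ hσ0 z hz
  obtain ⟨B, hB, hTb⟩ := aux_taylor b2 hb2 hb20 z hz
  rw [← hs] at hTσ
  rw [← hb] at hTb
  obtain ⟨c, hc, hcl⟩ := aux_lower σ hσ.continuousOn hσpos s A z hspos hA hz hTσ
  set r := b / s ^ 2 with hr
  have hr0 : 0 < r := by positivity
  set K := (B + r * A * (2 * s + A * z)) / c ^ 2 with hK
  have hK0 : 0 ≤ K := by positivity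
  have hrat : ∀ x, 0 < x → x ≤ z → |b2 x / σ x ^ 2 - r / x| ≤ K := fun x hx hxz =>
    aux_ratio (b2 x) (σ x) b s A B c z x hbpos hspos hA hc hx hxz (hTσ x ⟨hx.le, hxz⟩)
      (hTb x ⟨hx.le, hxz⟩) (hcl x ⟨hx.le, hxz⟩)
  -- continuity of the integrand
  have hcont : ∀ ε y : ℝ, 0 < y →
      ContinuousOn (fun l => (ε * b1 l - b2 l) / σ l ^ 2) (Icc y z) := by
    intro ε y hy
    have hsub : Icc y z ⊆ Ici 0 := fun x hx => hy.le.trans hx.1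
    exact ((continuousOn_const.mul (hb1.continuousOn.mono hsub)).sub
      (hb2.continuousOn.mono hsub)).div ((hσ.continuousOn.mono hsub).pow 2)
      (fun x hx => pow_ne_zero _ (hσpos x (hy.trans_le hx.1)).ne')
  have hint : ∀ ε y : ℝ, 0 < y → y ≤ z →
      IntervalIntegrable (fun l => (ε * b1 l - b2 l) / σ l ^ 2) volume y z := by
    intro ε y hy hyz
    apply ContinuousOn.intervalIntegrable
    rw [uIcc_of_le hyz]
    exact hcont ε y hy
  -- upper bound for the exponent
  have hup : ∀ ε y : ℝ, 0 < ε → ε ≤ y → y ≤ 2 * ε → 2 * ε ≤ z →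
      ∫ l in y..z, (ε * b1 l - b2 l) / σ l ^ 2 ≤
        (M / c ^ 2 + K * z + r * log (2 / z)) + r * log ε := by
    intro ε y hε hy hy2 hz2
    have hy0 : 0 < y := hε.trans_le hy
    have hyz : y ≤ z := hy2.trans hz2
    obtain ⟨h1, h2⟩ := aux_int (ε * M / c ^ 2) r K y z hy0 hyz
    have h3 := intervalIntegral.integral_mono_on hyz (hint ε y hy0 hyz) h1 (fun x hx => by
      have hx0 : 0 < x := hy0.trans_le hx.1
      have ha := (abs_le.1 (hrat x hx0 hx.2)).1
      have hsx := hσpos x hx0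
      have hb : ε * b1 x / σ x ^ 2 ≤ ε * M / c ^ 2 / x ^ 2 := by
        rw [div_div, ← mul_pow]
        exact div_le_div₀ (by positivity) (mul_le_mul_of_nonneg_left (hMb x hx0.le) hε.le)
          (by positivity) (pow_le_pow_left₀ (by positivity) (hcl x ⟨hx0.le, hx.2⟩) 2)
      rw [sub_div]
      linarith)
    rw [h2] at h3
    have h4 : ε * M / c ^ 2 / y ≤ M / c ^ 2 := by
      rw [div_le_iff₀ hy0]
      calc ε * M / c ^ 2 = M / c ^ 2 * ε := by ring
        _ ≤ _ := mul_le_mul_of_nonneg_left hy (by positivity)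
    have h5 : 0 ≤ ε * M / c ^ 2 / z := by positivity
    have h6 : log (2 / z) + log ε + log (z / y) = log (2 * ε / y) := by
      rw [log_div two_ne_zero hz.ne', log_div hz.ne' hy0.ne', log_div (by positivity) hy0.ne',
        log_mul two_ne_zero hε.ne']
      ring
    have h7 : 0 ≤ log (2 * ε / y) := log_nonneg (by rw [le_div_iff₀ hy0]; linarith)
    rw [← h6] at h7
    have h8 := mul_nonneg hr0.le h7
    have h9 := mul_nonneg hK0 hy0.le
    linarith
  -- lower bound for the exponent
  have hlow : ∀ ε y : ℝ, 0 < ε → z / 2 ≤ y → y ≤ z →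
      -(r * log 2 + K * z) ≤ ∫ l in y..z, (ε * b1 l - b2 l) / σ l ^ 2 := by
    intro ε y hε hy hyz
    have hy0 : 0 < y := by linarith
    obtain ⟨h1, h2⟩ := aux_int 0 r (-K) y z hy0 hyz
    have h3 := intervalIntegral.integral_mono_on hyz h1 (hint ε y hy0 hyz) (fun x hx => by
      have hx0 : 0 < x := hy0.trans_le hx.1
      have ha := (abs_le.1 (hrat x hx0 hx.2)).2
      have hsx := hσpos x hx0
      have hbx : 0 < b1 x := hm.trans_le (hmb x hx0.le)
      have hb : 0 ≤ ε * b1 x / σ x ^ 2 := by positivity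
      rw [sub_div, zero_div]
      linarith)
    rw [h2] at h3
    have h4 : log (z / y) ≤ log 2 :=
      log_le_log (by positivity) (by rw [div_le_iff₀ hy0]; linarith)
    have h5 := mul_le_mul_of_nonneg_left h4 hr0.le
    have h9 := mul_nonneg hK0 hy0.le
    simp only [zero_div] at h3
    linarith
  set D := Real.exp (M / c ^ 2 + K * z + r * log (2 / z)) with hD
  set E := Real.exp (-(r * log 2 + K * z)) with hE
  have hD0 : 0 < D := Real.exp_pos _
  have hE0 : 0 < E := Real.exp_pos _
  refine ⟨D / (E * (z / 2)), by positivity, z / 2, by positivity, fun ε hε hεz => ?_⟩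
  have hnum : (∫ y in ε..(2 * ε), Real.exp (∫ l in y..z, (ε * b1 l - b2 l) / σ l ^ 2)) ≤
      D * ε ^ (r + 1) := by
    have h := intervalIntegral.norm_integral_le_of_norm_le_const (a := ε) (b := 2 * ε)
      (f := fun y => Real.exp (∫ l in y..z, (ε * b1 l - b2 l) / σ l ^ 2)) (C := D * ε ^ r)
      (fun y hy => by
        rw [uIoc_of_le (by linarith)] at hy
        rw [Real.norm_eq_abs, abs_of_pos (Real.exp_pos _), Real.rpow_def_of_pos hε, hD,
          ← Real.exp_add, Real.exp_le_exp, mul_comm (log ε)]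
        exact hup ε y hε hy.1.le hy.2 (by linarith))
    refine (le_abs_self _).trans (h.trans (le_of_eq ?_))
    rw [Real.rpow_add_one hε.ne', show 2 * ε - ε = ε by ring, abs_of_pos hε]
    ring
  have hgc : ContinuousOn (fun y => Real.exp (∫ l in y..z, (ε * b1 l - b2 l) / σ l ^ 2))
      (Icc ε z) := by
    apply Real.continuous_exp.comp_continuousOn
    have h := intervalIntegral.continuousOn_primitive_interval_left (μ := volume)
      (f := fun l => (ε * b1 l - b2 l) / σ l ^ 2) (a := ε) (b := z)
      (by rw [uIcc_of_le (by linarith)]; exact (hcont ε ε hε).integrableOn_Icc)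
    rwa [uIcc_of_le (by linarith)] at h
  have hden : E * (z / 2) ≤
      ∫ y in ε..z, Real.exp (∫ l in y..z, (ε * b1 l - b2 l) / σ l ^ 2) := by
    have hsub : Icc (z / 2) z ⊆ Icc ε z := Icc_subset_Icc_left hεz.le
    have hi1 : IntervalIntegrable
        (fun y => Real.exp (∫ l in y..z, (ε * b1 l - b2 l) / σ l ^ 2)) volume ε z := by
      apply ContinuousOn.intervalIntegrable
      rwa [uIcc_of_le (by linarith)]
    have hi2 : IntervalIntegrable
        (fun y => Real.exp (∫ l in y..z, (ε * b1 l - b2 l) / σ l ^ 2)) volume (z / 2) z := by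
      apply ContinuousOn.intervalIntegrable
      rw [uIcc_of_le (by linarith)]
      exact hgc.mono hsub
    have h1 := intervalIntegral.integral_mono_interval (μ := volume) hεz.le
      (by linarith : z / 2 ≤ z) le_rfl (Eventually.of_forall fun y => (Real.exp_pos _).le) hi1
    have h2 := intervalIntegral.integral_mono_on (by linarith : z / 2 ≤ z)
      (intervalIntegrable_const (c := E)) hi2
      (fun y hy => Real.exp_le_exp.2 (hlow ε y hε hy.1 hy.2))
    rw [intervalIntegral.integral_const, smul_eq_mul] at h2
    have h3 : E * (z / 2) = (z - z / 2) * E := by ring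
    rw [h3]
    exact h2.trans h1
  calc _ ≤ D * ε ^ (r + 1) / (E * (z / 2)) :=
        div_le_div₀ (by positivity) hnum (by positivity) hden
    _ = _ := by ring
end

section
/- (Lemma 4.11 — asymptotics of the hitting probability in the Rabi model.) For all b > 0, l > 0 and z > 0 one has lim_{ε→0⁺} ε^{−2}·e^{b³/(6ε²)} · ( ∫_{ε/b}^{ε/b + lε²} exp(ε/(3x³) − b/(2x²)) dx ) / ( ∫_{ε/b}^z exp(ε/(3x³) − b/(2x²)) dx ) = ( ∫_0^l e^{(b⁵/2)x²} dx ) / ( ∫_0^z e^{−b/(2x²)} dx ). The left-hand ratio (without the prefactor) equals the probability that the diffusion started at ε/b + lε² hits z before ε/b, so this probability is asymptotically ε²·e^{−b³/(6ε²)}·(∫_0^l e^{(b⁵/2)x²}dx)/(∫_0^z e^{−b/(2x²)}dx). -/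
open MeasureTheory Real Set Filter
open scoped Topology

theorem num_aux (b l : ℝ) (hb : 0 < b) (hl : 0 < l) :
    Tendsto (fun ε : ℝ => ∫ u in (0 : ℝ)..l,
      Real.exp (b ^ 5 * u ^ 2 * (3 + b * ε * u) / (6 * (1 + b * ε * u) ^ 3)))
      (𝓝[>] (0 : ℝ)) (𝓝 (∫ x in (0 : ℝ)..l, Real.exp (b ^ 5 / 2 * x ^ 2))) := by
  apply intervalIntegral.tendsto_integral_filter_of_dominated_convergence
    (fun u => Real.exp (b ^ 5 / 2 * u ^ 2))
  · refine Eventually.of_forall fun ε => Measurable.aestronglyMeasurable ?_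
    fun_prop
  · filter_upwards [self_mem_nhdsWithin] with ε hε
    have hε : 0 < ε := hε
    refine Eventually.of_forall fun u hu => ?_
    rw [uIoc_of_le hl.le] at hu
    have hu0 : 0 < u := hu.1
    rw [Real.norm_eq_abs, abs_of_pos (Real.exp_pos _)]
    apply Real.exp_le_exp.mpr
    have ht : 0 < b * ε * u := by positivity
    generalize b * ε * u = t at ht
    rw [div_le_iff₀ (by positivity)]
    have h1 : 3 + t ≤ 3 * (1 + t) ^ 3 := by
      nlinarith [pow_pos ht 2, pow_pos ht 3]
    have h2 : 0 < b ^ 5 * u ^ 2 := by positivity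
    nlinarith [mul_le_mul_of_nonneg_left h1 h2.le]
  · exact Continuous.intervalIntegrable (by fun_prop) _ _
  · refine Eventually.of_forall fun u _ => ?_
    have : ContinuousAt (fun ε : ℝ =>
        Real.exp (b ^ 5 * u ^ 2 * (3 + b * ε * u) / (6 * (1 + b * ε * u) ^ 3))) 0 := by
      apply ContinuousAt.rexp
      apply ContinuousAt.div (by fun_prop) (by fun_prop)
      norm_num
    have h := this.tendsto.mono_left (nhdsWithin_le_nhds (s := Ioi 0))
    convert h using 3
    ring

theorem num_eq (b l ε : ℝ) (hb : 0 < b) (hl : 0 < l) (hε : 0 < ε) :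
    ε⁻¹ ^ 2 * Real.exp (b ^ 3 / (6 * ε ^ 2)) *
      (∫ x in (ε / b)..(ε / b + l * ε ^ 2), Real.exp (ε / (3 * x ^ 3) - b / (2 * x ^ 2)))
    = ∫ u in (0 : ℝ)..l,
      Real.exp (b ^ 5 * u ^ 2 * (3 + b * ε * u) / (6 * (1 + b * ε * u) ^ 3)) := by
  have h := intervalIntegral.smul_integral_comp_mul_add (a := 0) (b := l)
    (fun x => Real.exp (ε / (3 * x ^ 3) - b / (2 * x ^ 2))) (ε ^ 2) (ε / b)
  rw [mul_zero, zero_add, show ε ^ 2 * l + ε / b = ε / b + l * ε ^ 2 by ring] at h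
  rw [← h, smul_eq_mul, show ∀ A B : ℝ, ε⁻¹ ^ 2 * A * (ε ^ 2 * B) = A * B by
    intro A B; field_simp, ← intervalIntegral.integral_const_mul]
  apply intervalIntegral.integral_congr
  intro u hu
  rw [uIcc_of_le hl.le] at hu
  have hu0 : 0 ≤ u := hu.1
  simp only
  rw [← Real.exp_add]
  congr 1
  have ht : 0 < 1 + b * ε * u := by positivity
  rw [show ε ^ 2 * u + ε / b = ε / b * (1 + b * ε * u) by field_simp; ring]
  field_simp
  ring

theorem den_aux (b z : ℝ) (hb : 0 < b) (hz : 0 < z) :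
    Tendsto (fun ε : ℝ => ∫ x in (ε / b)..z, Real.exp (ε / (3 * x ^ 3) - b / (2 * x ^ 2)))
      (𝓝[>] (0 : ℝ)) (𝓝 (∫ x in (0 : ℝ)..z, Real.exp (-(b / (2 * x ^ 2))))) := by
  have key : Tendsto (fun ε : ℝ => ∫ x in (0 : ℝ)..z,
      (Ioi (ε / b)).indicator (fun x => Real.exp (ε / (3 * x ^ 3) - b / (2 * x ^ 2))) x)
      (𝓝[>] (0 : ℝ)) (𝓝 (∫ x in (0 : ℝ)..z, Real.exp (-(b / (2 * x ^ 2))))) := by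
    apply intervalIntegral.tendsto_integral_filter_of_dominated_convergence (fun _ => (1 : ℝ))
    · refine Eventually.of_forall fun ε => Measurable.aestronglyMeasurable ?_
      exact Measurable.indicator (by fun_prop) measurableSet_Ioi
    · filter_upwards [self_mem_nhdsWithin] with ε hε
      have hε : 0 < ε := hε
      refine Eventually.of_forall fun x hx => ?_
      rw [uIoc_of_le hz.le] at hx
      have hx0 : 0 < x := hx.1
      by_cases h : x ∈ Ioi (ε / b)
      · rw [indicator_of_mem h, Real.norm_eq_abs, abs_of_pos (Real.exp_pos _), Real.exp_le_one_iff]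
        have h' : ε < x * b := (div_lt_iff₀ hb).1 h
        rw [sub_nonpos, div_le_div_iff₀ (by positivity) (by positivity)]
        have h2 : 0 < x ^ 2 := by positivity
        have h3 : 0 < b * x ^ 3 := by positivity
        nlinarith [mul_lt_mul_of_pos_right h' h2]
      · rw [indicator_of_notMem h]; simp
    · exact intervalIntegrable_const
    · refine Eventually.of_forall fun x hx => ?_
      rw [uIoc_of_le hz.le] at hx
      have hx0 : 0 < x := hx.1
      have hc : Continuous (fun ε : ℝ => Real.exp (ε / (3 * x ^ 3) - b / (2 * x ^ 2))) := by
        fun_prop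
      have h := (hc.tendsto 0).mono_left (nhdsWithin_le_nhds (s := Ioi 0))
      simp only [zero_div, zero_sub] at h
      refine h.congr' ?_
      have : ∀ᶠ ε in 𝓝[>] (0 : ℝ), ε < x * b :=
        nhdsWithin_le_nhds (Iio_mem_nhds (by positivity))
      filter_upwards [this] with ε hε
      rw [indicator_of_mem]
      exact (div_lt_iff₀ hb).2 hε
  refine key.congr' ?_
  have : ∀ᶠ ε in 𝓝[>] (0 : ℝ), ε < z * b :=
    nhdsWithin_le_nhds (Iio_mem_nhds (by positivity))
  filter_upwards [this, self_mem_nhdsWithin] with ε h1 h2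
  have h2 : 0 < ε := h2
  have h3 : ε / b < z := (div_lt_iff₀ hb).2 h1
  rw [intervalIntegral.integral_of_le hz.le, intervalIntegral.integral_of_le h3.le,
    setIntegral_indicator measurableSet_Ioi, Ioc_inter_Ioi, max_eq_right (by positivity)]

theorem den_pos (b z : ℝ) (hb : 0 < b) (hz : 0 < z) :
    0 < ∫ x in (0 : ℝ)..z, Real.exp (-(b / (2 * x ^ 2))) := by
  apply intervalIntegral.intervalIntegral_pos_of_pos _ (fun x => Real.exp_pos _) hz
  refine (intervalIntegrable_const (c := (1 : ℝ))).mono_fun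
    (Measurable.aestronglyMeasurable (by fun_prop)) (Eventually.of_forall fun x => ?_)
  simp only [Real.norm_eq_abs, abs_of_pos (Real.exp_pos _), abs_one, Real.exp_le_one_iff]
  have : 0 ≤ b / (2 * x ^ 2) := by positivity
  linarith

/-- (Lemma 4.11 — asymptotics of the hitting probability in the Rabi model.) For all `b > 0`,
`l > 0` and `z > 0`:
`lim_{ε→0⁺} ε⁻²·e^{b³/(6ε²)}·(∫_{ε/b}^{ε/b+lε²} exp(ε/(3x³) − b/(2x²)) dx) /
  (∫_{ε/b}^z exp(ε/(3x³) − b/(2x²)) dx) = (∫_0^l e^{(b⁵/2)x²} dx)/(∫_0^z e^{−b/(2x²)} dx)`. -/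
theorem statement12 (b l z : ℝ) (hb : 0 < b) (hl : 0 < l) (hz : 0 < z) :
    Tendsto
      (fun ε : ℝ =>
        ε⁻¹ ^ 2 * Real.exp (b ^ 3 / (6 * ε ^ 2)) *
          ((∫ x in (ε / b)..(ε / b + l * ε ^ 2),
              Real.exp (ε / (3 * x ^ 3) - b / (2 * x ^ 2))) /
            (∫ x in (ε / b)..z, Real.exp (ε / (3 * x ^ 3) - b / (2 * x ^ 2)))))
      (𝓝[>] (0 : ℝ))
      (𝓝 ((∫ x in (0 : ℝ)..l, Real.exp (b ^ 5 / 2 * x ^ 2)) /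
        (∫ x in (0 : ℝ)..z, Real.exp (-(b / (2 * x ^ 2)))))) := by
  refine ((num_aux b l hb hl).div (den_aux b z hb hz) (den_pos b z hb hz).ne').congr' ?_
  filter_upwards [self_mem_nhdsWithin] with ε hε
  rw [Pi.div_apply, ← num_eq b l ε hb hl hε, mul_div_assoc]
end
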